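/- Let G^σ be a lower-optimal oriented graph (sr(G^σ) = r(G) − 2d(G)) and x a vertex on a cycle of G. Then the vertex-deleted oriented graph G^σ − x is also lower-optimal, x lies on exactly one cycle of G, and x is not adjacent to any pendant vertex of G. -/

import Mathlib

open scoped Classical

def IsSkewAdjMatrix {V : Type*} (G : SimpleGraph V) (S : Matrix V V ℝ) : Prop :=
  (∀ i j, G.Adj i j → S i j = 1 ∨ S i j = -1) ∧
  (∀ i j, ¬ G.Adj i j → S i j = 0) ∧
  (∀ i j, S j i = - S i j)

noncomputable def adjMat {V : Type*} (G : SimpleGraph V) : Matrix V V ℝ :=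
  Matrix.of fun i j => if G.Adj i j then 1 else 0

noncomputable def cycDim {V : Type*} (G : SimpleGraph V) : ℤ :=
  (G.edgeSet.ncard : ℤ) - Nat.card V + Nat.card G.ConnectedComponent

def OnCycle {V : Type*} (G : SimpleGraph V) (x : V) : Prop :=
  ∃ (u : V) (w : G.Walk u u), w.IsCycle ∧ x ∈ w.support


section LowerOptimalHelpers

open SimpleGraph

universe u

theorem rank_col_del {V W : Type*} [Fintype V] [Fintype W] (A : Matrix W V ℝ) (x : V) :
    A.rank ≤ (A.submatrix id (Subtype.val : ({x}ᶜ : Set V) → V)).rank + 1 := by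
  rw [Matrix.rank_eq_finrank_span_cols, Matrix.rank_eq_finrank_span_cols]
  have h1 : Submodule.span ℝ (Set.range A.col) ≤
      Submodule.span ℝ (Set.range (A.submatrix id (Subtype.val : ({x}ᶜ : Set V) → V)).col) ⊔
        Submodule.span ℝ {A.col x} := by
    rw [Submodule.span_le]
    rintro _ ⟨v, rfl⟩
    by_cases hv : v = x
    · subst hv
      exact Submodule.mem_sup_right (Submodule.subset_span rfl)
    · exact Submodule.mem_sup_left (Submodule.subset_span ⟨⟨v, hv⟩, rfl⟩)
  have h2 := Submodule.finrank_mono h1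
  have h3 := Submodule.finrank_add_le_finrank_add_finrank
    (Submodule.span ℝ (Set.range (A.submatrix id (Subtype.val : ({x}ᶜ : Set V) → V)).col))
    (Submodule.span ℝ {A.col x})
  have h4 : Module.finrank ℝ (Submodule.span ℝ {A.col x}) ≤ 1 := by
    simpa using finrank_span_le_card (R := ℝ) {A.col x}
  omega

theorem rank_del {V : Type*} [Fintype V] (A : Matrix V V ℝ) (x : V) :
    A.rank ≤ (A.submatrix (Subtype.val : ({x}ᶜ : Set V) → V)
      (Subtype.val : ({x}ᶜ : Set V) → V)).rank + 2 := by
  have h1 := rank_col_del A x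
  have h2 := rank_col_del (A.submatrix id (Subtype.val : ({x}ᶜ : Set V) → V)).transpose x
  rw [Matrix.rank_transpose] at h2
  have h3 : ((A.submatrix id (Subtype.val : ({x}ᶜ : Set V) → V)).transpose.submatrix id
      (Subtype.val : ({x}ᶜ : Set V) → V)) = (A.submatrix (Subtype.val : ({x}ᶜ : Set V) → V)
      (Subtype.val : ({x}ᶜ : Set V) → V)).transpose := rfl
  rw [h3, Matrix.rank_transpose] at h2
  omega

theorem rank_pendant {V : Type*} [Fintype V] (A : Matrix V V ℝ) (x y : V) (hyx : y ≠ x)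
    (h0 : ∀ z, z ≠ x → A y z = 0) (h1 : A y x ≠ 0) :
    (A.submatrix (Subtype.val : ({x}ᶜ : Set V) → V)
      (Subtype.val : ({x}ᶜ : Set V) → V)).rank < A.rank := by
  refine lt_of_lt_of_le ?_ (Matrix.rank_submatrix_le A (Subtype.val : ({x}ᶜ : Set V) → V) id)
  rw [Matrix.rank_eq_finrank_span_cols, Matrix.rank_eq_finrank_span_cols]
  apply Submodule.finrank_lt_finrank_of_lt
  rw [SetLike.lt_iff_le_and_exists]
  constructor
  · apply Submodule.span_mono
    rintro _ ⟨v, rfl⟩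
    exact ⟨v, rfl⟩
  · refine ⟨_, Submodule.subset_span ⟨x, rfl⟩, fun hmem => ?_⟩
    have : Submodule.span ℝ (Set.range (A.submatrix (Subtype.val : ({x}ᶜ : Set V) → V)
      (Subtype.val : ({x}ᶜ : Set V) → V)).col) ≤
        LinearMap.ker (LinearMap.proj (R := ℝ) (φ := fun _ : ({x}ᶜ : Set V) => ℝ) ⟨y, hyx⟩) := by
      rw [Submodule.span_le]
      rintro _ ⟨v, rfl⟩
      exact h0 v v.2
    exact h1 (this hmem)

theorem adjMat_induce {V : Type*} (G : SimpleGraph V) (s : Set V) :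
    adjMat (G.induce s) = (adjMat G).submatrix Subtype.val Subtype.val := by
  ext i j
  simp [adjMat]

theorem skew_induce {V : Type*} (G : SimpleGraph V) (s : Set V) (S : Matrix V V ℝ)
    (hS : IsSkewAdjMatrix G S) :
    IsSkewAdjMatrix (G.induce s) (S.submatrix Subtype.val Subtype.val) :=
  ⟨fun i j h => hS.1 i j h, fun i j h => hS.2.1 i j h, fun i j => hS.2.2 i j⟩

theorem exists_leaf {V : Type*} [Finite V] [Nonempty V] (G : SimpleGraph V) (h : G.IsAcyclic) :
    ∃ y z : V, ∀ w, G.Adj y w → w = z := by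
  have ⟨u, v, p, hp, hmax⟩ := Walk.exists_isPath_forall_isPath_length_le_length G
  refine ⟨u, p.snd, fun w hadj => ?_⟩
  apply h.eq_snd_of_adj_start hp hadj
  have : ¬(p.cons hadj.symm).IsPath := by grind [Walk.length_cons]
  grind [hp.cons]

theorem acyclic_scale (n : ℕ) : ∀ (V : Type u) [Fintype V] (G : SimpleGraph V) (S : Matrix V V ℝ),
    Fintype.card V = n → G.IsAcyclic → IsSkewAdjMatrix G S →
    ∃ D E : V → ℝ, (∀ i, D i ≠ 0) ∧ (∀ i, E i ≠ 0) ∧ ∀ i j, S i j = D i * adjMat G i j * E j := by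
  induction n with
  | zero =>
    intro V _ G S hc _ _
    have := Fintype.card_eq_zero_iff.mp hc
    exact ⟨fun _ => 1, fun _ => 1, by simp, by simp, fun i => this.elim i⟩
  | succ n ih =>
    intro V _ G S hc hG hS
    have : Nonempty V := Fintype.card_pos_iff.mp (by omega)
    obtain ⟨y, z, hz⟩ := exists_leaf G hG
    have hc' : Fintype.card ({y}ᶜ : Set V) = n := by
      rw [Fintype.card_compl_set]; simp [hc]
    obtain ⟨D, E, hD, hE, hDE⟩ := ih _ (G.induce {y}ᶜ) _ hc' (hG.induce _) (skew_induce G _ S hS)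
    have hne : ∀ i j, G.Adj i j → S i j ≠ 0 := by
      intro i j h
      rcases hS.1 i j h with h | h <;> rw [h] <;> norm_num
    by_cases hyz : G.Adj y z
    · have hzy : z ≠ y := hyz.ne'
      refine ⟨fun i => if h : i = y then S y z / E ⟨z, hzy⟩ else D ⟨i, h⟩,
        fun i => if h : i = y then S z y / D ⟨z, hzy⟩ else E ⟨i, h⟩, ?_, ?_, ?_⟩
      · intro i
        by_cases h : i = y
        · simp [h, hne _ _ hyz, hE]
        · simp [h, hD]
      · intro i
        by_cases h : i = y
        · simp [h, hne _ _ hyz.symm, hD]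
        · simp [h, hE]
      · intro i j
        by_cases hij : G.Adj i j
        · by_cases hi : i = y
          · subst hi
            have hj := hz _ hij
            subst hj
            simp [hzy, adjMat, hij, hE]
          · by_cases hj : j = y
            · subst hj
              have hj := hz _ hij.symm
              subst hj
              have := hD ⟨i, hzy⟩
              simp [hzy, adjMat, hij]
              field_simp
            · have := hDE ⟨i, hi⟩ ⟨j, hj⟩
              simpa [hi, hj, adjMat] using this
        · simp [adjMat, hij, hS.2.1 i j hij]
    · have hy : ∀ w, ¬ G.Adj y w := fun w hw => hyz (hz w hw ▸ hw)
      refine ⟨fun i => if h : i = y then 1 else D ⟨i, h⟩,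
        fun i => if h : i = y then 1 else E ⟨i, h⟩, ?_, ?_, ?_⟩
      · intro i
        by_cases h : i = y
        · simp [h]
        · simp [h, hD]
      · intro i
        by_cases h : i = y
        · simp [h]
        · simp [h, hE]
      · intro i j
        by_cases hij : G.Adj i j
        · have hi : i ≠ y := fun h => hy j (h ▸ hij)
          have hj : j ≠ y := fun h => hy i (h ▸ hij.symm)
          have := hDE ⟨i, hi⟩ ⟨j, hj⟩
          simpa [hi, hj, adjMat] using this
        · simp [adjMat, hij, hS.2.1 i j hij]

theorem acyclic_rank {V : Type u} [Fintype V] (G : SimpleGraph V) (S : Matrix V V ℝ)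
    (hG : G.IsAcyclic) (hS : IsSkewAdjMatrix G S) : (adjMat G).rank = S.rank := by
  obtain ⟨D, E, hD, hE, h⟩ := acyclic_scale _ V G S rfl hG hS
  have : S = Matrix.diagonal D * adjMat G * Matrix.diagonal E := by
    ext i j
    rw [Matrix.mul_diagonal, Matrix.diagonal_mul, h]
  rw [this, Matrix.rank_mul_eq_left_of_det_ne_zero, Matrix.rank_mul_eq_right_of_det_ne_zero]
  · simp [Matrix.det_diagonal, Finset.prod_ne_zero_iff, hD]
  · simp [Matrix.det_diagonal, Finset.prod_ne_zero_iff, hE]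

end LowerOptimalHelpers

section LowerOptimalHelpers2

open SimpleGraph

universe u

def nbrs {V : Type*} (G : SimpleGraph V) (x : V) : Set ({x}ᶜ : Set V) := {v | G.Adj x v}

def touch {V : Type*} (G : SimpleGraph V) (x : V) : Set (G.induce {x}ᶜ).ConnectedComponent :=
  (G.induce {x}ᶜ).connectedComponentMk '' nbrs G x

theorem walk_del {V : Type*} (G : SimpleGraph V) (x a b : V) (p : G.Walk a b) (ha : a ≠ x) :
    (G.induce {x}ᶜ).connectedComponentMk ⟨a, ha⟩ ∈ touch G x ∨
      ∃ hb : b ≠ x, (G.induce {x}ᶜ).Reachable ⟨a, ha⟩ ⟨b, hb⟩ := by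
  induction p with
  | nil => exact Or.inr ⟨ha, Reachable.refl _⟩
  | @cons u c w h p ih =>
    by_cases hc : c = x
    · subst hc
      exact Or.inl ⟨⟨u, ha⟩, h.symm, rfl⟩
    · have hadj : (G.induce {x}ᶜ).Adj ⟨u, ha⟩ ⟨c, hc⟩ := h
      rcases ih hc with h1 | ⟨hb, h1⟩
      · left
        rwa [ConnectedComponent.sound hadj.reachable]
      · exact Or.inr ⟨hb, hadj.reachable.trans h1⟩

theorem touch_reach {V : Type*} (G : SimpleGraph V) (x : V) (a : ({x}ᶜ : Set V))
    (h : (G.induce {x}ᶜ).connectedComponentMk a ∈ touch G x) : G.Reachable a x := by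
  obtain ⟨b, hb, he⟩ := h
  have h1 := (ConnectedComponent.exact he).map (Embedding.induce ({x}ᶜ : Set V)).toHom
  have h2 : G.Adj x b := hb
  exact (h2.reachable.trans h1).symm

theorem comp_count {V : Type*} [Finite V] (G : SimpleGraph V) (x : V) :
    Nat.card (G.induce {x}ᶜ).ConnectedComponent + 1 =
      Nat.card G.ConnectedComponent + (touch G x).ncard := by
  let f : (G.induce {x}ᶜ).ConnectedComponent → G.ConnectedComponent :=
    fun c => c.map (Embedding.induce ({x}ᶜ : Set V)).toHom
  have hf : ∀ a : ({x}ᶜ : Set V), f ((G.induce {x}ᶜ).connectedComponentMk a) =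
      G.connectedComponentMk a := fun a => rfl
  have hinj : Set.InjOn f (touch G x)ᶜ := by
    intro c hc d hd
    induction c using ConnectedComponent.ind with | _ a =>
    induction d using ConnectedComponent.ind with | _ b =>
    intro h
    rw [hf, hf] at h
    obtain ⟨p⟩ := ConnectedComponent.exact h
    rcases walk_del G x a b p a.2 with h | ⟨hb, h⟩
    · exact absurd h hc
    · exact ConnectedComponent.sound h
  have himg : f '' (touch G x)ᶜ = {G.connectedComponentMk x}ᶜ := by
    ext c
    constructor
    · rintro ⟨d, hd, rfl⟩
      induction d using ConnectedComponent.ind with | _ a =>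
      intro h
      rw [hf] at h
      obtain ⟨p⟩ := ConnectedComponent.exact h
      rcases walk_del G x a x p a.2 with h | ⟨hb, h⟩
      · exact absurd h hd
      · exact hb rfl
    · induction c using ConnectedComponent.ind with | _ a =>
      intro h
      have ha : a ≠ x := fun he => h (by rw [he]; rfl)
      refine ⟨(G.induce {x}ᶜ).connectedComponentMk ⟨a, ha⟩, fun hm => h ?_, rfl⟩
      exact ConnectedComponent.sound (touch_reach G x ⟨a, ha⟩ hm)
  have h1 := hinj.ncard_image
  rw [himg] at h1
  have h2 := Set.ncard_add_ncard_compl (touch G x)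
  have h3 := Set.ncard_add_ncard_compl ({G.connectedComponentMk x})
  rw [Set.ncard_singleton] at h3
  omega

theorem nbrs_ncard {V : Type*} [Fintype V] (G : SimpleGraph V) (x : V) :
    (nbrs G x).ncard = G.degree x := by
  rw [← Set.ncard_image_of_injective _ Subtype.val_injective, ← card_neighborSet_eq_degree,
    ← Nat.card_eq_fintype_card, Nat.card_coe_set_eq]
  congr 1
  ext v
  simp only [nbrs, Set.mem_image, Set.mem_ofPred_eq, mem_neighborSet]
  constructor
  · rintro ⟨a, h, rfl⟩
    exact h
  · intro h
    exact ⟨⟨v, h.ne'⟩, h, rfl⟩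

theorem edge_count {V : Type*} [Fintype V] (G : SimpleGraph V) (x : V) :
    G.edgeSet.ncard = (G.induce {x}ᶜ).edgeSet.ncard + (nbrs G x).ncard := by
  have h1 := card_edgeFinset_induce_compl_singleton G x
  have h2 := card_edgeFinset_deleteIncidenceSet G x
  have h3 : G.degree x ≤ G.edgeFinset.card := by
    rw [← card_incidenceFinset_eq_degree]
    exact Finset.card_le_card (G.incidenceFinset_subset x)
  rw [nbrs_ncard, ← coe_edgeFinset, ← coe_edgeFinset, Set.ncard_coe_finset, Set.ncard_coe_finset]
  omega

theorem cycDim_del {V : Type*} [Fintype V] (G : SimpleGraph V) (x : V) :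
    cycDim G = cycDim (G.induce {x}ᶜ) + (nbrs G x).ncard - (touch G x).ncard := by
  have h1 := comp_count G x
  have h2 := edge_count G x
  have h3 := Set.ncard_add_ncard_compl ({x} : Set V)
  rw [Set.ncard_singleton, ← Nat.card_coe_set_eq] at h3
  unfold cycDim
  omega

theorem touch_le {V : Type*} [Finite V] (G : SimpleGraph V) (x : V) :
    (touch G x).ncard ≤ (nbrs G x).ncard := Set.ncard_image_le

theorem cycDim_nonneg (n : ℕ) : ∀ (V : Type u) [Fintype V] (G : SimpleGraph V),
    Fintype.card V = n → 0 ≤ cycDim G := by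
  induction n with
  | zero =>
    intro V _ G hc
    have := Fintype.card_eq_zero_iff.mp hc
    unfold cycDim
    simp
  | succ n ih =>
    intro V _ G hc
    obtain ⟨x⟩ : Nonempty V := Fintype.card_pos_iff.mp (by omega)
    have hc' : Fintype.card ({x}ᶜ : Set V) = n := by
      rw [Fintype.card_compl_set]; simp [hc]
    have := ih _ (G.induce {x}ᶜ) hc'
    have := cycDim_del G x
    have := touch_le G x
    omega

theorem image_sub {α β : Type*} [Finite α] (f : α → β) (N : Set α) (a b : α) (ha : a ∈ N)
    (hb : b ∈ N) (hab : a ≠ b) (hf : f a = f b) : f '' N = f '' (N \ {a}) := by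
  apply subset_antisymm
  · rintro _ ⟨c, hc, rfl⟩
    by_cases h : c = a
    · subst h
      exact ⟨b, ⟨hb, hab.symm⟩, hf.symm⟩
    · exact ⟨c, ⟨hc, h⟩, rfl⟩
  · exact Set.image_mono Set.sdiff_subset

theorem collide_lt {α β : Type*} [Finite α] (f : α → β) (N : Set α) (a b : α) (ha : a ∈ N)
    (hb : b ∈ N) (hab : a ≠ b) (hf : f a = f b) : (f '' N).ncard + 1 ≤ N.ncard := by
  rw [image_sub f N a b ha hb hab hf, ← Set.ncard_sdiff_singleton_add_one ha]
  have := Set.ncard_image_le (f := f) (s := N \ {a})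
  omega

theorem collide_mem {α β : Type*} [Finite α] (f : α → β) (N : Set α) (a b c d : α) (ha : a ∈ N)
    (hb : b ∈ N) (hab : a ≠ b) (hf : f a = f b) (hc : c ∈ N)
    (hd : d ∈ N) (hcd : c ≠ d) (hf' : f c = f d) (hN : N.ncard ≤ (f '' N).ncard + 1) :
    a = c ∨ a = d := by
  by_contra! hne
  rw [image_sub f N a b ha hb hab hf, ← Set.ncard_sdiff_singleton_add_one ha] at hN
  have := collide_lt f (N \ {a}) c d ⟨hc, hne.1.symm⟩ ⟨hd, hne.2.symm⟩ hcd hf'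
  omega

theorem cycle_nbrs {V : Type*} (G : SimpleGraph V) (y u : V) (w : G.Walk u u)
    (hw : w.IsCycle) (hy : y ∈ w.support) :
    ∃ a b : ({y}ᶜ : Set V), a ∈ nbrs G y ∧ b ∈ nbrs G y ∧ a ≠ b ∧
      (G.induce {y}ᶜ).connectedComponentMk a = (G.induce {y}ᶜ).connectedComponentMk b ∧
      ∀ z : V, s(y, z) ∈ w.edges ↔ (z = a ∨ z = b) := by
  have hr := hw.rotate hy
  have he := w.rotate_edges y hy
  generalize w.rotate y hy = p at hr he
  have hn := hr.neighborSet_toSubgraph_endpoint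
  have hne := hr.snd_ne_penultimate
  have h1 : G.Adj y p.snd := p.adj_snd hr.not_nil
  have h2 : G.Adj p.penultimate y := p.adj_penultimate hr.not_nil
  refine ⟨⟨p.snd, h1.ne'⟩, ⟨p.penultimate, h2.ne⟩, h1, h2.symm,
    fun h => hne (congrArg Subtype.val h), ?_, ?_⟩
  · apply ConnectedComponent.sound
    cases p with
    | nil => exact absurd hr (by simp)
    | @cons _ c _ hadj q =>
      have hq : q.IsPath := by simpa using hr.isPath_tail
      have hnil : ¬ q.Nil := fun hn' => hadj.ne' hn'.eq
      have hs := Walk.support_dropLast_concat hnil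
      have hnd := hq.support_nodup
      rw [← hs, ← List.concat_eq_append, List.nodup_concat] at hnd
      have hpen := Walk.penultimate_cons_of_not_nil hadj q hnil
      have hwalk := (q.dropLast.induce (s := {y}ᶜ) (fun z hz hzy => hnd.1 (hzy ▸ hz))).reachable
      simpa only [hpen, Walk.snd_cons] using hwalk
  · intro z
    rw [← he.mem_iff, ← Walk.mem_edges_toSubgraph, Subgraph.mem_edgeSet, ← Subgraph.mem_neighborSet,
      hn]
    rfl

theorem cyc_drop {V : Type*} [Fintype V] (G : SimpleGraph V) (x : V) (hx : OnCycle G x) :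
    cycDim (G.induce {x}ᶜ) + 1 ≤ cycDim G := by
  obtain ⟨u, w, hw, hxw⟩ := hx
  obtain ⟨a, b, ha, hb, hab, hf, -⟩ := cycle_nbrs G x u w hw hxw
  have h1 := collide_lt _ _ a b ha hb hab hf
  have h2 := cycDim_del G x
  unfold touch at h2
  omega

theorem cyc_edges {V : Type*} [Fintype V] (G : SimpleGraph V) (y u v : V)
    (hd : cycDim G ≤ cycDim (G.induce {y}ᶜ) + 1) (w₁ : G.Walk u u) (w₂ : G.Walk v v)
    (h₁ : w₁.IsCycle) (h₂ : w₂.IsCycle) (hy₁ : y ∈ w₁.support) (hy₂ : y ∈ w₂.support) (z : V)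
    (hz : s(y, z) ∈ w₁.edges) : s(y, z) ∈ w₂.edges := by
  obtain ⟨a, b, ha, hb, hab, hf, he⟩ := cycle_nbrs G y u w₁ h₁ hy₁
  obtain ⟨c, d, hc, hd', hcd, hf', he'⟩ := cycle_nbrs G y v w₂ h₂ hy₂
  have h2 := cycDim_del G y
  unfold touch at h2
  have h3 : (nbrs G y).ncard ≤
      ((G.induce {y}ᶜ).connectedComponentMk '' nbrs G y).ncard + 1 := by omega
  rw [he']
  rcases (he z).1 hz with rfl | rfl
  · rcases collide_mem _ _ a b c d ha hb hab hf hc hd' hcd hf' h3 with h | h <;> simp [h]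
  · rcases collide_mem _ _ b a c d hb ha hab.symm hf.symm hc hd' hcd hf' h3 with h | h <;> simp [h]

theorem walk_edges {V : Type*} (G : SimpleGraph V) (P Q : Set (Sym2 V)) (X : Set V)
    (h : ∀ y ∈ X, ∀ z, s(y, z) ∈ P → s(y, z) ∈ Q ∧ z ∈ X) (a b : V) (p : G.Walk a b) (ha : a ∈ X)
    (hp : ∀ e ∈ p.edges, e ∈ P) : ∀ e ∈ p.edges, e ∈ Q := by
  induction p with
  | nil => simp
  | @cons u c w hadj p ih =>
    have h1 := h u ha c (hp _ (by simp))
    intro e he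
    rw [Walk.edges_cons, List.mem_cons] at he
    rcases he with rfl | he
    · exact h1.1
    · exact ih h1.2 (fun e he => hp e (by simp [he])) e he

theorem cyc_subset {V : Type*} (G : SimpleGraph V) (x u v : V)
    (w₁ : G.Walk u u) (w₂ : G.Walk v v)
    (h : ∀ y z, y ∈ w₁.support → y ∈ w₂.support → s(y, z) ∈ w₁.edges → s(y, z) ∈ w₂.edges)
    (hx₁ : x ∈ w₁.support) (hx₂ : x ∈ w₂.support) : ∀ e ∈ w₁.edges, e ∈ w₂.edges := by
  have he := w₁.rotate_edges x hx₁
  intro e hew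
  refine walk_edges G {e | e ∈ w₁.edges} {e | e ∈ w₂.edges} {y | y ∈ w₁.support ∧ y ∈ w₂.support}
    ?_ x x (w₁.rotate x hx₁) ⟨hx₁, hx₂⟩ (fun e h => he.mem_iff.1 h) e (he.mem_iff.2 hew)
  rintro y ⟨hy₁, hy₂⟩ z hz
  have h1 := h y z hy₁ hy₂ hz
  exact ⟨h1, w₁.snd_mem_support_of_mem_edges hz, w₂.snd_mem_support_of_mem_edges h1⟩

end LowerOptimalHelpers2

section LowerOptimalHelpers3

open SimpleGraph

universe u

theorem lower_bound (n : ℕ) : ∀ (V : Type u) [Fintype V] (G : SimpleGraph V) (S : Matrix V V ℝ),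
    Fintype.card V = n → IsSkewAdjMatrix G S →
    ((adjMat G).rank : ℤ) - 2 * cycDim G ≤ (S.rank : ℤ) := by
  induction n with
  | zero =>
    intro V _ G S hc hS
    have := Fintype.card_eq_zero_iff.mp hc
    have h1 := cycDim_nonneg 0 V G hc
    have h2 := (adjMat G).rank_le_card_width
    omega
  | succ n ih =>
    intro V _ G S hc hS
    by_cases hG : G.IsAcyclic
    · have h1 := cycDim_nonneg _ V G hc
      have h2 := acyclic_rank G S hG hS
      omega
    · obtain ⟨x, hx⟩ : ∃ x, OnCycle G x := by
        by_contra hno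
        push Not at hno
        apply hG
        intro v w hw
        exact hno v ⟨v, w, hw, w.start_mem_support⟩
      have hc' : Fintype.card ({x}ᶜ : Set V) = n := by
        rw [Fintype.card_compl_set]; simp [hc]
      have h1 := ih _ (G.induce {x}ᶜ) _ hc' (skew_induce G _ S hS)
      have h2 := cyc_drop G x hx
      have h3 := rank_del (adjMat G) x
      have h4 := Matrix.rank_submatrix_le S (Subtype.val : ({x}ᶜ : Set V) → V)
        (Subtype.val : ({x}ᶜ : Set V) → V)
      rw [adjMat_induce] at h1
      omega

theorem lower_opt_del {V : Type u} [Fintype V] (G : SimpleGraph V) (S : Matrix V V ℝ)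
    (hS : IsSkewAdjMatrix G S)
    (hlo : (S.rank : ℤ) = ((adjMat G).rank : ℤ) - 2 * cycDim G)
    (x : V) (hx : OnCycle G x) :
    ((S.submatrix (Subtype.val : ({x}ᶜ : Set V) → V) (Subtype.val : ({x}ᶜ : Set V) → V)).rank : ℤ) =
      ((adjMat G).submatrix (Subtype.val : ({x}ᶜ : Set V) → V)
        (Subtype.val : ({x}ᶜ : Set V) → V)).rank - 2 * cycDim (G.induce {x}ᶜ) ∧
    cycDim G = cycDim (G.induce {x}ᶜ) + 1 ∧
    (S.submatrix (Subtype.val : ({x}ᶜ : Set V) → V)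
      (Subtype.val : ({x}ᶜ : Set V) → V)).rank = S.rank := by
  have h1 := lower_bound _ _ (G.induce {x}ᶜ) _ rfl (skew_induce G _ S hS)
  have h2 := cyc_drop G x hx
  have h3 := rank_del (adjMat G) x
  have h4 := Matrix.rank_submatrix_le S (Subtype.val : ({x}ᶜ : Set V) → V)
    (Subtype.val : ({x}ᶜ : Set V) → V)
  rw [adjMat_induce] at h1
  omega

theorem induce_cast {V : Type u} [Fintype V] (G : SimpleGraph V) (S : Matrix V V ℝ)
    (x : V) (F : Finset V) (hF : (F : Set V) = {x}ᶜ)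
    (h : ((S.submatrix (Subtype.val : ({x}ᶜ : Set V) → V)
        (Subtype.val : ({x}ᶜ : Set V) → V)).rank : ℤ) =
      ((adjMat G).submatrix (Subtype.val : ({x}ᶜ : Set V) → V)
        (Subtype.val : ({x}ᶜ : Set V) → V)).rank - 2 * cycDim (G.induce {x}ᶜ)) :
    (((S.submatrix (fun w : F => (w : V)) (fun w : F => (w : V))).rank : ℤ) =
      (((adjMat G).submatrix (fun w : F => (w : V)) (fun w : F => (w : V))).rank : ℤ) -
      2 * cycDim (G.induce (↑F : Set V))) := by
  have key : ∀ M : Matrix V V ℝ, (M.submatrix (fun w : F => (w : V)) (fun w : F => (w : V))).rank =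
      (M.submatrix (Subtype.val : ({x}ᶜ : Set V) → V)
        (Subtype.val : ({x}ᶜ : Set V) → V)).rank := by
    intro M
    let e : F ≃ ({x}ᶜ : Set V) := Equiv.subtypeEquivRight (fun v => by
      rw [← hF]; rfl)
    exact Matrix.rank_submatrix (M.submatrix (Subtype.val : ({x}ᶜ : Set V) → V)
        (Subtype.val : ({x}ᶜ : Set V) → V)) e e
  rw [key, key, hF, h]

end LowerOptimalHelpers3

/-- If G^σ is lower-optimal and x lies on a cycle of G, then G^σ - x is also
lower-optimal, x lies on exactly one cycle of G, and x is not adjacent to any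
pendant vertex of G. -/
theorem lowerOptimal_delete_cycle_vertex' {V : Type*} [Fintype V] [DecidableEq V]
    (G : SimpleGraph V) (S : Matrix V V ℝ) (hS : IsSkewAdjMatrix G S)
    (hlo : (S.rank : ℤ) = ((adjMat G).rank : ℤ) - 2 * cycDim G)
    (x : V) (hx : OnCycle G x) :
    (((S.submatrix (fun w : ({x}ᶜ : Finset V) => (w : V))
        (fun w : ({x}ᶜ : Finset V) => (w : V))).rank : ℤ) =
      (((adjMat G).submatrix (fun w : ({x}ᶜ : Finset V) => (w : V))
        (fun w : ({x}ᶜ : Finset V) => (w : V))).rank : ℤ) -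
      2 * cycDim (G.induce (↑({x}ᶜ : Finset V) : Set V))) ∧
    (∀ (u v : V) (w₁ : G.Walk u u) (w₂ : G.Walk v v),
      w₁.IsCycle → w₂.IsCycle → x ∈ w₁.support → x ∈ w₂.support →
      w₁.edges.toFinset = w₂.edges.toFinset) ∧
    (¬ ∃ y, G.neighborSet y = {x}) := by
  obtain ⟨h1, h2, h3⟩ := lower_opt_del G S hS hlo x hx
  refine ⟨induce_cast G S x _ (by ext v; simp) h1, ?_, ?_⟩
  · intro u v w₁ w₂ hw₁ hw₂ hx₁ hx₂
    have hd : ∀ y, y ∈ w₁.support → cycDim G ≤ cycDim (G.induce {y}ᶜ) + 1 := fun y hy =>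
      (lower_opt_del G S hS hlo y ⟨u, w₁, hw₁, hy⟩).2.1.le
    have h12 := cyc_subset G x u v w₁ w₂ (fun y z hy₁ hy₂ hz =>
      cyc_edges G y u v (hd y hy₁) w₁ w₂ hw₁ hw₂ hy₁ hy₂ z hz) hx₁ hx₂
    have h21 := cyc_subset G x v u w₂ w₁ (fun y z hy₂ hy₁ hz =>
      cyc_edges G y v u (hd y hy₁) w₂ w₁ hw₂ hw₁ hy₂ hy₁ z hz) hx₂ hx₁
    ext e
    simp only [List.mem_toFinset]
    exact ⟨h12 e, h21 e⟩
  · rintro ⟨y, hy⟩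
    have hadj : G.Adj y x := by
      rw [← SimpleGraph.mem_neighborSet, hy]; rfl
    have h4 := rank_pendant S x y hadj.ne (fun z hz => hS.2.1 y z (fun h => hz (by
      rw [← SimpleGraph.mem_neighborSet, hy] at h; exact h))) (by
      rcases hS.1 y x hadj with h | h <;> rw [h] <;> norm_num)
    omega
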